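/- Let H ∈ ℝ with H ≠ 0, let Ω ⊆ ℝ² be open, and let u : Ω → ℝ be a smooth function satisfying ∂₁∂₂u = H e^{−u} on Ω. Let ξ : ℝ → ℝ³ be a three-times differentiable curve such that for all (z₁, z₂) ∈ Ω: ξ'''(z₂) = (2∂₂²u + (∂₂u)²)(z₁,z₂)·ξ'(z₂) + (∂₂³u + ∂₂u·∂₂²u − H)(z₁,z₂)·ξ(z₂). Define f : Ω → ℝ³ by f(z₁, z₂) = (1/H)(∂₂u(z₁,z₂)·ξ(z₂) − ξ'(z₂)). Then f satisfies on Ω the system: ∂₁²f = −∂₁u·∂₁f, ∂₂²f = e^{u}·∂₁f − ∂₂u·∂₂f, and ∂₁∂₂f = −H e^{−u}·f. -/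

import Mathlib

/-- First partial derivative of a scalar function on `ℝ²`. -/
noncomputable def pd1 (f : ℝ × ℝ → ℝ) : ℝ × ℝ → ℝ := fun x => fderiv ℝ f x (1, 0)

/-- Second partial derivative of a scalar function on `ℝ²`. -/
noncomputable def pd2 (f : ℝ × ℝ → ℝ) : ℝ × ℝ → ℝ := fun x => fderiv ℝ f x (0, 1)

/-- First partial derivative of an `ℝ³`-valued function on `ℝ²`. -/
noncomputable def pdv1 (f : ℝ × ℝ → Fin 3 → ℝ) : ℝ × ℝ → Fin 3 → ℝ :=
  fun x => fderiv ℝ f x (1, 0)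

/-- Second partial derivative of an `ℝ³`-valued function on `ℝ²`. -/
noncomputable def pdv2 (f : ℝ × ℝ → Fin 3 → ℝ) : ℝ × ℝ → Fin 3 → ℝ :=
  fun x => fderiv ℝ f x (0, 1)

theorem contDiffOn_pd2 {Ω : Set (ℝ × ℝ)} (hΩ : IsOpen Ω) {g : ℝ × ℝ → ℝ}
    (hg : ContDiffOn ℝ (⊤ : ℕ∞) g Ω) : ContDiffOn ℝ (⊤ : ℕ∞) (pd2 g) Ω :=
  (hg.fderiv_of_isOpen hΩ (by simp)).clm_apply contDiffOn_const

theorem pd1_pd2_comm {Ω : Set (ℝ × ℝ)} (hΩ : IsOpen Ω) {g : ℝ × ℝ → ℝ}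
    (hg : ContDiffOn ℝ (⊤ : ℕ∞) g Ω) {z : ℝ × ℝ} (hz : z ∈ Ω) :
    pd1 (pd2 g) z = pd2 (pd1 g) z := by
  have hgz : ContDiffAt ℝ (⊤ : ℕ∞) g z := hg.contDiffAt (hΩ.mem_nhds hz)
  have htwo : (1 + 1 : WithTop ℕ∞) ≤ (⊤ : ℕ∞) := by
    rw [one_add_one_eq_two]
    exact WithTop.coe_le_coe.2 (le_top (a := (2 : ℕ∞)))
  have hd : DifferentiableAt ℝ (fderiv ℝ g) z :=
    (hgz.fderiv_right (m := 1) htwo).differentiableAt (by simp)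
  have hsymm : IsSymmSndFDerivAt ℝ g z :=
    hgz.isSymmSndFDerivAt (by simpa [one_add_one_eq_two] using htwo)
  have happ (v w : ℝ × ℝ) :
      fderiv ℝ (fun x => fderiv ℝ g x v) z w = fderiv ℝ (fderiv ℝ g) z w v := by
    simp [fderiv_clm_apply hd (differentiableAt_const v)]
  unfold pd1 pd2
  rw [happ, happ]
  exact hsymm _ _

theorem Filter.EventuallyEq.pd2_eq {g h : ℝ × ℝ → ℝ} {z : ℝ × ℝ} (e : g =ᶠ[nhds z] h) :
    pd2 g z = pd2 h z := by
  rw [pd2, pd2, e.fderiv_eq]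

theorem Filter.EventuallyEq.pdv1_eq {g h : ℝ × ℝ → Fin 3 → ℝ} {z : ℝ × ℝ}
    (e : g =ᶠ[nhds z] h) : pdv1 g z = pdv1 h z := by
  rw [pdv1, pdv1, e.fderiv_eq]

theorem Filter.EventuallyEq.pdv2_eq {g h : ℝ × ℝ → Fin 3 → ℝ} {z : ℝ × ℝ}
    (e : g =ᶠ[nhds z] h) : pdv2 g z = pdv2 h z := by
  rw [pdv2, pdv2, e.fderiv_eq]

theorem hasFDerivAt_comp_snd {η : ℝ → Fin 3 → ℝ} {z : ℝ × ℝ}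
    (hη : DifferentiableAt ℝ η z.2) :
    HasFDerivAt (fun x : ℝ × ℝ => η x.2)
      ((ContinuousLinearMap.snd ℝ ℝ ℝ).smulRight (deriv η z.2)) z := by
  refine (hη.hasDerivAt.hasFDerivAt.comp z hasFDerivAt_snd).congr_fderiv ?_
  ext <;> simp

theorem fderiv_exp_neg_apply {u : ℝ × ℝ → ℝ} {z : ℝ × ℝ} (hu : DifferentiableAt ℝ u z) (v : ℝ × ℝ) :
    fderiv ℝ (fun x => Real.exp (-u x)) z v = -(fderiv ℝ u z v * Real.exp (-u z)) := by
  refine (DFunLike.congr_fun hu.hasFDerivAt.neg.exp.fderiv v).trans ?_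
  simp [mul_comm]

/-- the analytic core of Corollary 2. If `u` solves the Liouville
equation `∂₁∂₂u = H e^{−u}` on `Ω`, the curve `ξ` solves the third-order ODE
`ξ''' = (2∂₂²u + (∂₂u)²)ξ' + (∂₂³u + ∂₂u·∂₂²u − H)ξ` along `Ω`, and
`f = (1/H)(∂₂u·ξ − ξ')`, then `f` satisfies the fundamental system (F):
`∂₁²f = −∂₁u·∂₁f`, `∂₂²f = e^{u}∂₁f − ∂₂u·∂₂f`, `∂₁∂₂f = −H e^{−u} f` on `Ω`. -/
theorem stmt10 (H : ℝ) (hH : H ≠ 0) (Ω : Set (ℝ × ℝ)) (hΩ : IsOpen Ω)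
    (u : ℝ × ℝ → ℝ) (hu : ContDiffOn ℝ (⊤ : ℕ∞) u Ω)
    (hLiou : ∀ x ∈ Ω, pd1 (pd2 u) x = H * Real.exp (-u x))
    (ξ : ℝ → Fin 3 → ℝ)
    (hξ1 : Differentiable ℝ ξ)
    (hξ2 : Differentiable ℝ (deriv ξ))
    (hξ3 : Differentiable ℝ (deriv (deriv ξ)))
    (hODE : ∀ z ∈ Ω, deriv (deriv (deriv ξ)) z.2
        = (2 * pd2 (pd2 u) z + (pd2 u z) ^ 2) • deriv ξ z.2
          + (pd2 (pd2 (pd2 u)) z + pd2 u z * pd2 (pd2 u) z - H) • ξ z.2)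
    (f : ℝ × ℝ → Fin 3 → ℝ)
    (hf : f = fun z => (1 / H) • (pd2 u z • ξ z.2 - deriv ξ z.2)) :
    (∀ z ∈ Ω, pdv1 (pdv1 f) z = (-pd1 u z) • pdv1 f z) ∧
    (∀ z ∈ Ω, pdv2 (pdv2 f) z = Real.exp (u z) • pdv1 f z - pd2 u z • pdv2 f z) ∧
    (∀ z ∈ Ω, pdv1 (pdv2 f) z = (-(H * Real.exp (-u z))) • f z) := by
  have hnhds {z} (hz : z ∈ Ω) : Ω ∈ nhds z := hΩ.mem_nhds hz
  have diff {g : ℝ × ℝ → ℝ} (hg : ContDiffOn ℝ (⊤ : ℕ∞) g Ω) {z} (hz : z ∈ Ω) :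
      DifferentiableAt ℝ g z := (hg.contDiffAt (hnhds hz)).differentiableAt (by simp)
  have hu2 := contDiffOn_pd2 hΩ hu
  have hu22 := contDiffOn_pd2 hΩ hu2
  have hfderiv {z} (hz : z ∈ Ω) :=
    ((((diff hu2 hz).hasFDerivAt.smul (hasFDerivAt_comp_snd (hξ1 z.2))).sub
      (hasFDerivAt_comp_snd (hξ2 z.2))).const_smul (1 / H)).fderiv
  have hf1 {z} (hz : z ∈ Ω) : pdv1 f z = Real.exp (-u z) • ξ z.2 := by
    have h := hLiou z hz
    rw [pdv1, hf]
    refine (DFunLike.congr_fun (hfderiv hz) _).trans ?_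
    rw [pd1] at h
    ext i
    simp [h]
    field_simp
  have hf2 {z} (hz : z ∈ Ω) : pdv2 f z = (1 / H) •
      (pd2 (pd2 u) z • ξ z.2 + pd2 u z • deriv ξ z.2 - deriv (deriv ξ) z.2) := by
    rw [pdv2, hf]
    refine (DFunLike.congr_fun (hfderiv hz) _).trans ?_
    ext i
    simp [show fderiv ℝ (pd2 u) z (0, 1) = pd2 (pd2 u) z from rfl, add_comm]
  have hf2deriv {z} (hz : z ∈ Ω) :=
    (((((diff hu22 hz).hasFDerivAt.smul (hasFDerivAt_comp_snd (hξ1 z.2))).add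
      ((diff hu2 hz).hasFDerivAt.smul (hasFDerivAt_comp_snd (hξ2 z.2)))).sub
      (hasFDerivAt_comp_snd (hξ3 z.2))).const_smul (1 / H)).fderiv
  have hf1ev {z} (hz : z ∈ Ω) : pdv1 f =ᶠ[nhds z] fun x => Real.exp (-u x) • ξ x.2 :=
    Filter.eventuallyEq_of_mem (hnhds hz) fun _ => hf1
  have hf2ev {z} (hz : z ∈ Ω) : pdv2 f =ᶠ[nhds z] fun z => (1 / H) •
      (pd2 (pd2 u) z • ξ z.2 + pd2 u z • deriv ξ z.2 - deriv (deriv ξ) z.2) :=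
    Filter.eventuallyEq_of_mem (hnhds hz) fun _ => hf2
  refine ⟨fun z hz => ?_, fun z hz => ?_, fun z hz => ?_⟩
  · rw [(hf1ev hz).pdv1_eq, hf1 hz, pdv1]
    have hd := (diff hu hz).neg.exp.hasFDerivAt.smul (hasFDerivAt_comp_snd (hξ1 z.2))
    refine (DFunLike.congr_fun hd.fderiv _).trans ?_
    have h := fderiv_exp_neg_apply (diff hu hz) (1, 0)
    ext i
    simp [h, pd1]
    ring
  · rw [(hf2ev hz).pdv2_eq, hf1 hz, hf2 hz, pdv2]
    refine (DFunLike.congr_fun (hf2deriv hz) _).trans ?_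
    ext i
    simp [show ∀ g, fderiv ℝ g z (0, 1) = pd2 g z from fun _ => rfl, hODE z hz, Real.exp_neg]
    field_simp
    ring
  · rw [(hf2ev hz).pdv1_eq, hf, pdv1]
    refine (DFunLike.congr_fun (hf2deriv hz) _).trans ?_
    have h122 : pd1 (pd2 (pd2 u)) z = -(H * pd2 u z * Real.exp (-u z)) := by
      rw [pd1_pd2_comm hΩ hu2 hz,
        (Filter.eventuallyEq_of_mem (hnhds hz) hLiou).pd2_eq, pd2,
        fderiv_const_mul (diff hu hz).fun_neg.exp]
      simp [fderiv_exp_neg_apply (diff hu hz), pd2]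
      ring
    ext i
    simp [show ∀ g, fderiv ℝ g z (1, 0) = pd1 g z from fun _ => rfl, h122, hLiou z hz]
    field_simp
    ring
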